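/- arXiv:1210.0727 — 7 statements merged into one kernel-verified Lean document; each statement's English description precedes it below -/
import Mathlib

section
/- For every spinor ψ = (ψ₁, ψ₂) ∈ ℂ², the triple product of the associated real vectors satisfies ⟨a(ψ) × b(ψ), c(ψ)⟩ = (|ψ₁|² + |ψ₂|²)³, where × is the cross product in ℝ³; in particular, if ψ ≠ 0 then the ordered basis (a(ψ), b(ψ), c(ψ)) is positively oriented, i.e., det(a(ψ), b(ψ), c(ψ)) > 0. -/
open Complex

noncomputable section

/-- The mate (or conjugate) of a spinor `ψ = (ψ₁, ψ₂)` is `ψ̂ = (-conj ψ₂, conj ψ₁)`. -/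
def mate (ψ : ℂ × ℂ) : ℂ × ℂ := (-(starRingEnd ℂ) ψ.2, (starRingEnd ℂ) ψ.1)

/-- The real vector `a(ψ) = (Re(ψ₁² - ψ₂²), -Im(ψ₁² + ψ₂²), -2 Re(ψ₁ψ₂))`. -/
def sa (ψ : ℂ × ℂ) : EuclideanSpace ℝ (Fin 3) :=
  !₂[(ψ.1 ^ 2 - ψ.2 ^ 2).re, -(ψ.1 ^ 2 + ψ.2 ^ 2).im, -2 * (ψ.1 * ψ.2).re]

/-- The real vector `b(ψ) = (Im(ψ₁² - ψ₂²), Re(ψ₁² + ψ₂²), -2 Im(ψ₁ψ₂))`. -/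
def sb (ψ : ℂ × ℂ) : EuclideanSpace ℝ (Fin 3) :=
  !₂[(ψ.1 ^ 2 - ψ.2 ^ 2).im, (ψ.1 ^ 2 + ψ.2 ^ 2).re, -2 * (ψ.1 * ψ.2).im]

/-- The real vector `c(ψ) = (2 Re(ψ₁ conj ψ₂), -2 Im(ψ₁ conj ψ₂), |ψ₁|² - |ψ₂|²)`. -/
def sc (ψ : ℂ × ℂ) : EuclideanSpace ℝ (Fin 3) :=
  !₂[2 * (ψ.1 * (starRingEnd ℂ) ψ.2).re, -2 * (ψ.1 * (starRingEnd ℂ) ψ.2).im,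
    ‖ψ.1‖ ^ 2 - ‖ψ.2‖ ^ 2]

/-- Reinterpret a plain vector in `Fin 3 → ℝ` as an element of Euclidean 3-space. -/
def toE (v : Fin 3 → ℝ) : EuclideanSpace ℝ (Fin 3) := WithLp.toLp 2 v


/-- The triple product `⟨a(ψ) × b(ψ), c(ψ)⟩` equals `(|ψ₁|² + |ψ₂|²)³`; in particular,
for `ψ ≠ 0` the ordered basis `(a(ψ), b(ψ), c(ψ))` is positively oriented. -/
theorem spinor_vectors_triple_product (ψ : ℂ × ℂ) :
    inner ℝ (toE ((crossProduct (sa ψ).ofLp) (sb ψ).ofLp)) (sc ψ)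
        = (‖ψ.1‖ ^ 2 + ‖ψ.2‖ ^ 2) ^ 3 ∧
    (ψ ≠ 0 → 0 < Matrix.det (Matrix.of ![((sa ψ).ofLp : Fin 3 → ℝ), (sb ψ).ofLp, (sc ψ).ofLp])) := by
  have h : ∀ z : ℂ, ‖z‖ ^ 2 = z.re ^ 2 + z.im ^ 2 := fun z => by
    rw [Complex.sq_norm, Complex.normSq_apply]; ring
  have hdet : Matrix.det (Matrix.of ![((sa ψ).ofLp : Fin 3 → ℝ), (sb ψ).ofLp, (sc ψ).ofLp])
      = (‖ψ.1‖ ^ 2 + ‖ψ.2‖ ^ 2) ^ 3 := by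
    simp [Matrix.det_fin_three, sa, sb, sc, h, pow_two (_ : ℂ)]
    ring
  refine ⟨?_, fun hψ => ?_⟩
  · simp [toE, sa, sb, sc, crossProduct, PiLp.inner_apply, Fin.sum_univ_three, h, pow_two (_ : ℂ)]
    ring
  · rw [hdet]
    have : 0 < ‖ψ.1‖ ^ 2 + ‖ψ.2‖ ^ 2 := by
      by_cases h1 : ψ.1 = 0
      · have h2 : ψ.2 ≠ 0 := fun h2 => hψ (Prod.ext h1 h2)
        have := norm_pos_iff.mpr h2
        positivity
      · have := norm_pos_iff.mpr h1
        positivity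
    positivity
end
end

section
/- If a, b, c ∈ ℝ³ are mutually orthogonal vectors of the same Euclidean norm (⟨a,b⟩ = ⟨a,c⟩ = ⟨b,c⟩ = 0 and ‖a‖ = ‖b‖ = ‖c‖) satisfying ⟨a × b, c⟩ > 0, then there exists a spinor ψ = (ψ₁, ψ₂) ∈ ℂ² such that a = a(ψ), b = b(ψ) and c = c(ψ). -/
open Complex

noncomputable section

/-- A positively oriented orthogonal triad of equal lengths `r` satisfies `r c = a × b`. -/
lemma triad_cross (a1 a2 a3 b1 b2 b3 c1 c2 c3 r : ℝ) (hr : 0 ≤ r)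
    (hA : a1 ^ 2 + a2 ^ 2 + a3 ^ 2 = r ^ 2) (hB : b1 ^ 2 + b2 ^ 2 + b3 ^ 2 = r ^ 2)
    (hC : c1 ^ 2 + c2 ^ 2 + c3 ^ 2 = r ^ 2)
    (hab : a1 * b1 + a2 * b2 + a3 * b3 = 0) (hac : a1 * c1 + a2 * c2 + a3 * c3 = 0)
    (hbc : b1 * c1 + b2 * c2 + b3 * c3 = 0)
    (hpos : 0 < (a2 * b3 - a3 * b2) * c1 + (a3 * b1 - a1 * b3) * c2 + (a1 * b2 - a2 * b1) * c3) :
    0 < r ∧ r * c1 = a2 * b3 - a3 * b2 ∧ r * c2 = a3 * b1 - a1 * b3 ∧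
      r * c3 = a1 * b2 - a2 * b1 := by
  have hD : (a2 * b3 - a3 * b2) ^ 2 + (a3 * b1 - a1 * b3) ^ 2 + (a1 * b2 - a2 * b1) ^ 2
      = r ^ 4 := by
    have : (a2 * b3 - a3 * b2) ^ 2 + (a3 * b1 - a1 * b3) ^ 2 + (a1 * b2 - a2 * b1) ^ 2
      = (a1 ^ 2 + a2 ^ 2 + a3 ^ 2) * (b1 ^ 2 + b2 ^ 2 + b3 ^ 2)
        - (a1 * b1 + a2 * b2 + a3 * b3) ^ 2 := by ring
    rw [this, hA, hB, hab]; ring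
  have hT : ((a2 * b3 - a3 * b2) * c1 + (a3 * b1 - a1 * b3) * c2 + (a1 * b2 - a2 * b1) * c3) ^ 2
      = (r ^ 3) ^ 2 := by
    have : ((a2 * b3 - a3 * b2) * c1 + (a3 * b1 - a1 * b3) * c2
          + (a1 * b2 - a2 * b1) * c3) ^ 2
      = (a1 ^ 2 + a2 ^ 2 + a3 ^ 2) * ((b1 ^ 2 + b2 ^ 2 + b3 ^ 2) * (c1 ^ 2 + c2 ^ 2 + c3 ^ 2)
          - (b1 * c1 + b2 * c2 + b3 * c3) ^ 2)
        - (a1 * b1 + a2 * b2 + a3 * b3) * ((a1 * b1 + a2 * b2 + a3 * b3)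
            * (c1 ^ 2 + c2 ^ 2 + c3 ^ 2)
          - (b1 * c1 + b2 * c2 + b3 * c3) * (a1 * c1 + a2 * c2 + a3 * c3))
        + (a1 * c1 + a2 * c2 + a3 * c3) * ((a1 * b1 + a2 * b2 + a3 * b3)
            * (b1 * c1 + b2 * c2 + b3 * c3)
          - (b1 ^ 2 + b2 ^ 2 + b3 ^ 2) * (a1 * c1 + a2 * c2 + a3 * c3)) := by ring
    rw [this, hA, hB, hC, hab, hac, hbc]; ring
  have hT' := (sq_eq_sq₀ hpos.le (by positivity)).1 hT
  have hr' : 0 < r := by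
    rcases hr.eq_or_lt with h | h
    · rw [hT', ← h] at hpos; norm_num at hpos
    · exact h
  have key : (r * c1 - (a2 * b3 - a3 * b2)) ^ 2 + (r * c2 - (a3 * b1 - a1 * b3)) ^ 2
      + (r * c3 - (a1 * b2 - a2 * b1)) ^ 2 = 0 := by
    linear_combination r ^ 2 * hC + hD - 2 * r * hT'
  have h1 := sq_nonneg (r * c1 - (a2 * b3 - a3 * b2))
  have h2 := sq_nonneg (r * c2 - (a3 * b1 - a1 * b3))
  have h3 := sq_nonneg (r * c3 - (a1 * b2 - a2 * b1))
  refine ⟨hr', ?_, ?_, ?_⟩ <;> refine sub_eq_zero.1 (pow_eq_zero_iff (two_ne_zero)|>.1 ?_) <;>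
    linarith

/-- Two complex numbers whose product is a square have compatible square roots. -/
lemma exists_roots (P Q w : ℂ) (h : P * Q = w ^ 2) :
    ∃ p q : ℂ, p ^ 2 = P ∧ q ^ 2 = Q ∧ p * q = w := by
  obtain ⟨p, hp⟩ := IsAlgClosed.exists_pow_nat_eq P (n := 2) two_pos
  obtain ⟨q, hq⟩ := IsAlgClosed.exists_pow_nat_eq Q (n := 2) two_pos
  have : (p * q) ^ 2 = w ^ 2 := by rw [mul_pow, hp, hq, h]
  rcases sq_eq_sq_iff_eq_or_eq_neg.1 this with h | h
  · exact ⟨p, q, hp, hq, h⟩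
  · exact ⟨p, -q, hp, by rw [neg_sq, hq], by rw [mul_neg, h, neg_neg]⟩

/-- If `a, b, c ∈ ℝ³` are mutually orthogonal of the same Euclidean norm with
`⟨a × b, c⟩ > 0`, then there exists a spinor `ψ` with `a = a(ψ)`, `b = b(ψ)`, `c = c(ψ)`. -/
theorem exists_spinor_of_orthogonal_triad (a b c : EuclideanSpace ℝ (Fin 3))
    (hab : inner ℝ a b = (0 : ℝ)) (hac : inner ℝ a c = (0 : ℝ)) (hbc : inner ℝ b c = (0 : ℝ))
    (hnab : ‖a‖ = ‖b‖) (hnbc : ‖b‖ = ‖c‖)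
    (hpos : (0 : ℝ) < inner ℝ (toE ((crossProduct a.ofLp) b.ofLp)) c) :
    ∃ ψ : ℂ × ℂ, a = sa ψ ∧ b = sb ψ ∧ c = sc ψ := by
  have hA : a 0 ^ 2 + a 1 ^ 2 + a 2 ^ 2 = ‖c‖ ^ 2 := by
    rw [← hnbc, ← hnab, EuclideanSpace.real_norm_sq_eq, Fin.sum_univ_three]
  have hB : b 0 ^ 2 + b 1 ^ 2 + b 2 ^ 2 = ‖c‖ ^ 2 := by
    rw [← hnbc, EuclideanSpace.real_norm_sq_eq, Fin.sum_univ_three]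
  have hC : c 0 ^ 2 + c 1 ^ 2 + c 2 ^ 2 = ‖c‖ ^ 2 := by
    rw [EuclideanSpace.real_norm_sq_eq, Fin.sum_univ_three]
  have hr := norm_nonneg c
  generalize ‖c‖ = r at hA hB hC hr
  simp only [PiLp.inner_apply, Fin.sum_univ_three, RCLike.inner_apply, conj_trivial]
    at hab hac hbc hpos
  simp only [toE, cross_apply, Matrix.cons_val] at hpos
  obtain ⟨hr', e1, e2, e3⟩ := triad_cross (a 0) (a 1) (a 2) (b 0) (b 1) (b 2) (c 0) (c 1) (c 2) r
    hr hA hB hC (by linarith) (by linarith) (by linarith) (by linarith)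
  obtain ⟨p, q, hp, hq, hpq⟩ := exists_roots ⟨(a 0 + b 1) / 2, (b 0 - a 1) / 2⟩
    ⟨(b 1 - a 0) / 2, -(b 0 + a 1) / 2⟩ ⟨-a 2 / 2, -b 2 / 2⟩ (by
      apply Complex.ext <;> simp [pow_two]
      · linear_combination (hB - hA) / 4
      · linear_combination -hab / 2)
  obtain ⟨x, y⟩ := p
  obtain ⟨u, v⟩ := q
  simp only [Complex.ext_iff, pow_two, Complex.mul_re, Complex.mul_im] at hp hq hpq
  obtain ⟨p1, p2⟩ := hp
  obtain ⟨q1, q2⟩ := hq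
  obtain ⟨w1, w2⟩ := hpq
  have ha0 : a 0 = x * x - y * y - (u * u - v * v) := by linarith
  have ha1 : a 1 = -(x * y + y * x + (u * v + v * u)) := by linarith
  have ha2 : a 2 = -2 * (x * u - y * v) := by linarith
  have hb0 : b 0 = x * y + y * x - (u * v + v * u) := by linarith
  have hb1 : b 1 = x * x - y * y + (u * u - v * v) := by linarith
  have hb2 : b 2 = -2 * (x * v + y * u) := by linarith
  have hN : r = x ^ 2 + y ^ 2 + u ^ 2 + v ^ 2 := by
    refine (sq_eq_sq₀ hr (by positivity)).1 ?_
    have : r ^ 2 = (a 0 ^ 2 + a 1 ^ 2 + a 2 ^ 2 + b 0 ^ 2 + b 1 ^ 2 + b 2 ^ 2) / 2 := by linarith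
    rw [this, ha0, ha1, ha2, hb0, hb1, hb2]; ring
  have hc0 : c 0 = 2 * (x * u + y * v) := by
    apply mul_left_cancel₀ hr'.ne'
    rw [e1, ha1, ha2, hb1, hb2, hN]; ring
  have hc1 : c 1 = -2 * (y * u - x * v) := by
    apply mul_left_cancel₀ hr'.ne'
    rw [e2, ha0, ha2, hb0, hb2, hN]; ring
  have hc2 : c 2 = x * x + y * y - (u * u + v * v) := by
    apply mul_left_cancel₀ hr'.ne'
    rw [e3, ha0, ha1, hb0, hb1, hN]; ring
  refine ⟨(⟨x, y⟩, ⟨u, v⟩), ?_, ?_, ?_⟩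
  · ext i
    fin_cases i <;> simp [sa, pow_two, ha0, ha1, ha2] <;> ring
  · ext i
    fin_cases i <;> simp [sb, pow_two, hb0, hb1, hb2] <;> ring
  · ext i
    fin_cases i <;> simp [sc, Complex.sq_norm, Complex.normSq_apply, hc0, hc1, hc2] <;> ring
end
end

section
/- The spinor associated to an ordered orthogonal triad is unique up to sign: if two spinors ψ, φ ∈ ℂ² satisfy a(ψ) = a(φ), b(ψ) = b(φ) and c(ψ) = c(φ), then φ = ψ or φ = −ψ. -/
open Complex

noncomputable section

/-- The spinor associated to an ordered orthogonal triad is unique up to sign. -/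
theorem spinor_unique_up_to_sign (ψ φ : ℂ × ℂ)
    (ha : sa ψ = sa φ) (hb : sb ψ = sb φ) (hc : sc ψ = sc φ) :
    φ = ψ ∨ φ = -ψ := by
  have a0 := congrArg (fun v => v 0) ha
  have a1 := congrArg (fun v => v 1) ha
  have a2 := congrArg (fun v => v 2) ha
  have b0 := congrArg (fun v => v 0) hb
  have b1 := congrArg (fun v => v 1) hb
  have b2 := congrArg (fun v => v 2) hb
  obtain ⟨p, q⟩ := ψ
  obtain ⟨r, s⟩ := φ
  simp only [sa, sb, PiLp.toLp_apply, Matrix.cons_val, Complex.sub_re, Complex.sub_im,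
    Complex.add_re, Complex.add_im] at a0 a1 a2 b0 b1 b2
  have h1 : r ^ 2 = p ^ 2 := by
    apply Complex.ext <;> linarith
  have h2 : s ^ 2 = q ^ 2 := by
    apply Complex.ext <;> linarith
  have h3 : r * s = p * q := by
    apply Complex.ext <;> linarith
  simp only [Prod.mk.injEq, Prod.neg_mk]
  by_cases hp : p = 0
  · subst hp
    have hr : r = 0 := by simpa using h1
    subst hr
    simpa using sq_eq_sq_iff_eq_or_eq_neg.mp h2
  · rcases sq_eq_sq_iff_eq_or_eq_neg.mp h1 with h | h
    · left
      subst h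
      exact ⟨rfl, mul_left_cancel₀ hp h3⟩
    · right
      subst h
      refine ⟨rfl, mul_left_cancel₀ hp ?_⟩
      linear_combination -h3
end
end

section
/- Spinor Frenet equation: let ψ : ℝ → ℂ² be differentiable with |ψ₁(s)|² + |ψ₂(s)|² = 1 for all s, let κ, τ : ℝ → ℝ, and set N(s) = a(ψ(s)), B(s) = b(ψ(s)), T(s) = c(ψ(s)). If the Frenet equations hold, i.e., T′(s) = κ(s)·N(s), N′(s) = −κ(s)·T(s) + τ(s)·B(s) and B′(s) = −τ(s)·N(s) for all s, then ψ satisfies the single spinor equation ψ′(s) = (1/2)·(−i·τ(s)·ψ(s) + κ(s)·ψ̂(s)) for all s. -/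
open Complex

noncomputable section

/-- Derivative of a vector in Euclidean 3-space, computed by coordinates. -/
theorem hasDerivAt_vec3 {f g h : ℝ → ℝ} {f' g' h' s : ℝ} (hf : HasDerivAt f f' s)
    (hg : HasDerivAt g g' s) (hh : HasDerivAt h h' s) :
    HasDerivAt (fun t => (!₂[f t, g t, h t] : EuclideanSpace ℝ (Fin 3))) !₂[f', g', h'] s := by
  have h1 : HasDerivAt (fun t => ![f t, g t, h t]) ![f', g', h'] s := by
    rw [hasDerivAt_pi]
    intro i
    fin_cases i
    · simpa using hf
    · simpa using hg
    · simpa using hh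
  exact ((PiLp.continuousLinearEquiv 2 ℝ (fun _ : Fin 3 => ℝ)).symm.toContinuousLinearMap.hasFDerivAt).comp_hasDerivAt s h1

/-- The pointwise algebra behind the theorem. -/
theorem spinor_algebra (p q p' q' : ℂ) (k t : ℂ) (hpq : p ≠ 0 ∨ q ≠ 0)
    (h1 : 2 * (p * p') = -k * (p * (starRingEnd ℂ) q) - I * t * p ^ 2)
    (h2 : 2 * (q * q') = k * (q * (starRingEnd ℂ) p) - I * t * q ^ 2)
    (h3 : 2 * (p' * q + p * q') = k * (p * (starRingEnd ℂ) p - q * (starRingEnd ℂ) q)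
      - 2 * I * t * (p * q)) :
    2 * p' = -k * (starRingEnd ℂ) q - I * t * p ∧ 2 * q' = k * (starRingEnd ℂ) p - I * t * q := by
  rcases hpq with hp | hq
  · have e : 2 * p' = -k * (starRingEnd ℂ) q - I * t * p := by
      apply mul_left_cancel₀ hp
      linear_combination h1
    refine ⟨e, ?_⟩
    apply mul_left_cancel₀ hp
    linear_combination h3 - q * e
  · have e : 2 * q' = k * (starRingEnd ℂ) p - I * t * q := by
      apply mul_left_cancel₀ hq
      linear_combination h2
    refine ⟨?_, e⟩
    apply mul_left_cancel₀ hq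
    linear_combination h3 - p * e

/-- Spinor Frenet equation: if the triad `N = a(ψ), B = b(ψ), T = c(ψ)` associated to a
unit differentiable spinor field satisfies the Frenet equations with curvature `κ` and
torsion `τ`, then `ψ' = (1/2)(-iτψ + κψ̂)`. -/
theorem spinor_frenet_equation (ψ : ℝ → ℂ × ℂ) (hψ : Differentiable ℝ ψ)
    (hunit : ∀ s, ‖(ψ s).1‖ ^ 2 + ‖(ψ s).2‖ ^ 2 = 1)
    (κ τ : ℝ → ℝ)
    (hT : ∀ s, deriv (fun t => sc (ψ t)) s = κ s • sa (ψ s))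
    (hN : ∀ s, deriv (fun t => sa (ψ t)) s = (-κ s) • sc (ψ s) + τ s • sb (ψ s))
    (hB : ∀ s, deriv (fun t => sb (ψ t)) s = (-τ s) • sa (ψ s)) :
    ∀ s, deriv ψ s
      = ((1 : ℂ) / 2) • ((-Complex.I * (τ s : ℂ)) • ψ s + (κ s : ℂ) • mate (ψ s)) := by
  intro s
  have hd := (hψ s).hasDerivAt
  have hp : HasDerivAt (fun t => (ψ t).1) (deriv ψ s).1 s :=
    (ContinuousLinearMap.fst ℝ ℂ ℂ).hasFDerivAt.comp_hasDerivAt s hd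
  have hq : HasDerivAt (fun t => (ψ t).2) (deriv ψ s).2 s :=
    (ContinuousLinearMap.snd ℝ ℂ ℂ).hasFDerivAt.comp_hasDerivAt s hd
  have hre : ∀ {f : ℝ → ℂ} {f' : ℂ}, HasDerivAt f f' s →
      HasDerivAt (fun t => (f t).re) f'.re s := fun h =>
    reCLM.hasFDerivAt.comp_hasDerivAt s h
  have him : ∀ {f : ℝ → ℂ} {f' : ℂ}, HasDerivAt f f' s →
      HasDerivAt (fun t => (f t).im) f'.im s := fun h =>
    imCLM.hasFDerivAt.comp_hasDerivAt s h
  have hm := (hp.fun_pow 2).fun_sub (hq.fun_pow 2)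
  have ha := (hp.fun_pow 2).fun_add (hq.fun_pow 2)
  have hx := hp.fun_mul hq
  have dA := hasDerivAt_vec3 (hre hm) (him ha).fun_neg ((hre hx).const_mul (-2))
  have dB := hasDerivAt_vec3 (him hm) (hre ha) ((him hx).const_mul (-2))
  have eA := dA.deriv.symm.trans (hN s)
  have eB := dB.deriv.symm.trans (hB s)
  have hu := hunit s
  have hne : (ψ s).1 ≠ 0 ∨ (ψ s).2 ≠ 0 := by
    by_contra! hc
    simp [hc.1, hc.2] at hu
  clear dA dB hm ha hx hre him hp hq hd hunit hT hN hB hψ hu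
  generalize deriv ψ s = d at *
  generalize ψ s = w at *
  generalize κ s = k at *
  generalize τ s = t at *
  obtain ⟨p, q⟩ := w
  obtain ⟨p', q'⟩ := d
  have a0 := congrArg (fun v : EuclideanSpace ℝ (Fin 3) => v 0) eA
  have a1 := congrArg (fun v : EuclideanSpace ℝ (Fin 3) => v 1) eA
  have a2 := congrArg (fun v : EuclideanSpace ℝ (Fin 3) => v 2) eA
  have b0 := congrArg (fun v : EuclideanSpace ℝ (Fin 3) => v 0) eB
  have b1 := congrArg (fun v : EuclideanSpace ℝ (Fin 3) => v 1) eB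
  have b2 := congrArg (fun v : EuclideanSpace ℝ (Fin 3) => v 2) eB
  clear eA eB
  simp [sa, sb, sc, pow_two, Complex.mul_re, Complex.mul_im] at a0 a1 a2 b0 b1 b2 hne
  have nz : ∀ z : ℂ, ‖z‖ * ‖z‖ = z.re * z.re + z.im * z.im := fun z => by
    rw [Complex.norm_mul_self_eq_normSq, Complex.normSq_apply]
  rw [nz, nz] at a2
  have key := spinor_algebra p q p' q' k t (by tauto) ?_ ?_ ?_
  · obtain ⟨e1, e2⟩ := key
    ext1
    · simp only [mate, Prod.smul_mk, Prod.mk_add_mk, smul_eq_mul]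
      linear_combination e1 / 2
    · simp only [mate, Prod.smul_mk, Prod.mk_add_mk, smul_eq_mul]
      linear_combination e2 / 2
  · apply Complex.ext <;> simp [pow_two] <;> linarith
  · apply Complex.ext <;> simp [pow_two] <;> linarith
  · apply Complex.ext <;> simp [pow_two] <;> linarith
end
end

section
/- Converse of Theorem 1: let φ : ℝ → ℂ² be differentiable with |φ₁(s)|² + |φ₂(s)|² = 1 for all s, let k₁, k₂ : ℝ → ℝ, and set N₁(s) = a(φ(s)), N₂(s) = b(φ(s)), T(s) = c(φ(s)). If φ′(s) = (1/2)·(k₁(s) + i·k₂(s))·φ̂(s) for all s, then the type-1 Bishop equations hold: T′(s) = k₁(s)·N₁(s) + k₂(s)·N₂(s), N₁′(s) = −k₁(s)·T(s) and N₂′(s) = −k₂(s)·T(s) for all s. -/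
open Complex

noncomputable section

theorem hasDerivAt_re_im {f : ℝ → ℂ} {f' : ℂ} {s : ℝ} (h : HasDerivAt f f' s) :
    HasDerivAt (fun t => (f t).re) f'.re s ∧ HasDerivAt (fun t => (f t).im) f'.im s :=
  ⟨(Complex.reCLM.hasFDerivAt.comp_hasDerivAt s h), (Complex.imCLM.hasFDerivAt.comp_hasDerivAt s h)⟩

/-- Converse of Theorem 1: if a unit differentiable spinor field satisfies
`φ' = (1/2)(k₁ + i k₂) φ̂`, then the triad `N₁ = a(φ), N₂ = b(φ), T = c(φ)` satisfies
the type-1 Bishop equations with Bishop curvatures `k₁, k₂`. -/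
theorem type1_bishop_of_spinor_equation (φ : ℝ → ℂ × ℂ) (hφ : Differentiable ℝ φ)
    (hunit : ∀ s, ‖(φ s).1‖ ^ 2 + ‖(φ s).2‖ ^ 2 = 1)
    (k₁ k₂ : ℝ → ℝ)
    (hspinor : ∀ s, deriv φ s
      = ((1 : ℂ) / 2 * ((k₁ s : ℂ) + Complex.I * (k₂ s : ℂ))) • mate (φ s)) :
    (∀ s, deriv (fun t => sc (φ t)) s = k₁ s • sa (φ s) + k₂ s • sb (φ s)) ∧
    (∀ s, deriv (fun t => sa (φ t)) s = (-k₁ s) • sc (φ s)) ∧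
    (∀ s, deriv (fun t => sb (φ t)) s = (-k₂ s) • sc (φ s)) := by
  have key : ∀ s, HasDerivAt (fun t => (φ t).1.re)
        (1 / 2 * (-(k₁ s) * (φ s).2.re - k₂ s * (φ s).2.im)) s ∧
      HasDerivAt (fun t => (φ t).1.im)
        (1 / 2 * (k₁ s * (φ s).2.im - k₂ s * (φ s).2.re)) s ∧
      HasDerivAt (fun t => (φ t).2.re)
        (1 / 2 * (k₁ s * (φ s).1.re + k₂ s * (φ s).1.im)) s ∧
      HasDerivAt (fun t => (φ t).2.im)
        (1 / 2 * (-(k₁ s) * (φ s).1.im + k₂ s * (φ s).1.re)) s := by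
    intro s
    have h := (hφ s).hasDerivAt
    rw [hspinor s] at h
    have h1 : HasDerivAt (fun t => (φ t).1) _ s :=
      (ContinuousLinearMap.fst ℝ ℂ ℂ).hasFDerivAt.comp_hasDerivAt s h
    have h2 : HasDerivAt (fun t => (φ t).2) _ s :=
      (ContinuousLinearMap.snd ℝ ℂ ℂ).hasFDerivAt.comp_hasDerivAt s h
    obtain ⟨a, b⟩ := hasDerivAt_re_im h1
    obtain ⟨c, d⟩ := hasDerivAt_re_im h2
    refine ⟨a.congr_deriv ?_, b.congr_deriv ?_, c.congr_deriv ?_, d.congr_deriv ?_⟩ <;>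
      simp [mate] <;> ring
  have esa : ∀ ψ : ℂ × ℂ, sa ψ = !₂[ψ.1.re * ψ.1.re - ψ.1.im * ψ.1.im
        - (ψ.2.re * ψ.2.re - ψ.2.im * ψ.2.im),
      -(2 * (ψ.1.re * ψ.1.im) + 2 * (ψ.2.re * ψ.2.im)),
      -2 * (ψ.1.re * ψ.2.re - ψ.1.im * ψ.2.im)] := by
    intro ψ
    ext i
    fin_cases i <;> simp [sa, pow_two] <;> ring
  have esb : ∀ ψ : ℂ × ℂ, sb ψ = !₂[2 * (ψ.1.re * ψ.1.im) - 2 * (ψ.2.re * ψ.2.im),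
      ψ.1.re * ψ.1.re - ψ.1.im * ψ.1.im + (ψ.2.re * ψ.2.re - ψ.2.im * ψ.2.im),
      -2 * (ψ.1.re * ψ.2.im + ψ.1.im * ψ.2.re)] := by
    intro ψ
    ext i
    fin_cases i <;> simp [sb, pow_two] <;> ring
  have esc : ∀ ψ : ℂ × ℂ, sc ψ = !₂[2 * (ψ.1.re * ψ.2.re + ψ.1.im * ψ.2.im),
      -2 * (ψ.1.im * ψ.2.re - ψ.1.re * ψ.2.im),
      ψ.1.re * ψ.1.re + ψ.1.im * ψ.1.im - (ψ.2.re * ψ.2.re + ψ.2.im * ψ.2.im)] := by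
    intro ψ
    ext i
    fin_cases i <;> simp [sc, Complex.sq_norm, Complex.normSq_apply] <;> ring
  simp only [esa, esb, esc]
  refine ⟨fun s => ?_, fun s => ?_, fun s => ?_⟩ <;> obtain ⟨a, b, c, d⟩ := key s
  · rw [(hasDerivAt_vec3 (((a.fun_mul c).fun_add (b.fun_mul d)).const_mul 2)
      (((b.fun_mul c).fun_sub (a.fun_mul d)).const_mul (-2))
      (((a.fun_mul a).fun_add (b.fun_mul b)).fun_sub
        ((c.fun_mul c).fun_add (d.fun_mul d)))).deriv]
    ext i
    fin_cases i <;> simp <;> ring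
  · rw [(hasDerivAt_vec3 (((a.fun_mul a).fun_sub (b.fun_mul b)).fun_sub
        ((c.fun_mul c).fun_sub (d.fun_mul d)))
      (((a.fun_mul b).const_mul 2).fun_add ((c.fun_mul d).const_mul 2)).fun_neg
      (((a.fun_mul c).fun_sub (b.fun_mul d)).const_mul (-2))).deriv]
    ext i
    fin_cases i <;> simp <;> ring
  · rw [(hasDerivAt_vec3 (((a.fun_mul b).const_mul 2).fun_sub ((c.fun_mul d).const_mul 2))
      (((a.fun_mul a).fun_sub (b.fun_mul b)).fun_add
        ((c.fun_mul c).fun_sub (d.fun_mul d)))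
      (((a.fun_mul d).fun_add (b.fun_mul c)).const_mul (-2))).deriv]
    ext i
    fin_cases i <;> simp <;> ring
end
end

section
/- Theorem 2 (relation between the spinor formulations of the type-1 Bishop frame and the Frenet frame): let ψ, φ ∈ ℂ² be spinors and θ ∈ ℝ such that c(φ) = c(ψ) (equal tangent vectors) and the frames are related by a(ψ) = cos θ · a(φ) + sin θ · b(φ) and b(ψ) = −sin θ · a(φ) + cos θ · b(φ). Then the associated complex vectors satisfy φᵗσφ = e^{iθ}·(ψᵗσψ), i.e., for each coordinate j ∈ {1,2,3}: a(φ)ⱼ + i·b(φ)ⱼ = e^{iθ}·(a(ψ)ⱼ + i·b(ψ)ⱼ). -/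
open Complex

noncomputable section

/-- Theorem 2: relation between the spinor formulations of the type-1 Bishop frame and
the Frenet frame: if `c(φ) = c(ψ)` and `a(ψ) = cos θ a(φ) + sin θ b(φ)`,
`b(ψ) = -sin θ a(φ) + cos θ b(φ)`, then `φᵗσφ = e^{iθ} ψᵗσψ` coordinatewise. -/
theorem type1_bishop_frenet_spinor_relation (ψ φ : ℂ × ℂ) (θ : ℝ)
    (hT : sc φ = sc ψ)
    (ha : sa ψ = Real.cos θ • sa φ + Real.sin θ • sb φ)
    (hb : sb ψ = (-Real.sin θ) • sa φ + Real.cos θ • sb φ) :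
    ∀ j : Fin 3, (sa φ j : ℂ) + Complex.I * (sb φ j : ℂ)
      = Complex.exp (θ * Complex.I) * ((sa ψ j : ℂ) + Complex.I * (sb ψ j : ℂ)) := by
  intro j
  have h1 : sa ψ j = Real.cos θ * sa φ j + Real.sin θ * sb φ j := by
    rw [ha]; simp
  have h2 : sb ψ j = (-Real.sin θ) * sa φ j + Real.cos θ * sb φ j := by
    rw [hb]; simp
  have h3 : Complex.cos (θ : ℂ) ^ 2 + Complex.sin (θ : ℂ) ^ 2 = 1 :=
    Complex.cos_sq_add_sin_sq _
  rw [h1, h2, Complex.exp_mul_I]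
  push_cast
  linear_combination
    (-((sa φ j : ℂ) + Complex.I * (sb φ j : ℂ))) * h3
      + ((sa φ j : ℂ) + Complex.I * (sb φ j : ℂ)) * Complex.sin (θ : ℂ) ^ 2 * Complex.I_sq
      - ((sb φ j : ℂ) * Complex.sin (θ : ℂ) * Complex.cos (θ : ℂ)
          + Complex.I * (sb φ j : ℂ) * Complex.sin (θ : ℂ) ^ 2) * Complex.I_sq
end
end

section
/- Theorem 4 (relation between the spinor formulations of the type-2 Bishop frame and the Frenet frame): let ψ, λ ∈ ℂ² be spinors and θ ∈ ℝ such that c(ψ) = c(λ) (equal binormal vectors) and the frames are related by a(ψ) = sin θ · a(λ) − cos θ · b(λ) and b(ψ) = cos θ · a(λ) + sin θ · b(λ). Then the associated complex vectors satisfy λᵗσλ = −i·e^{iθ}·(ψᵗσψ), i.e., for each coordinate j ∈ {1,2,3}: a(λ)ⱼ + i·b(λ)ⱼ = −i·e^{iθ}·(a(ψ)ⱼ + i·b(ψ)ⱼ). -/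
open Complex

noncomputable section

/-- Theorem 4: relation between the spinor formulations of the type-2 Bishop frame and
the Frenet frame: if `c(ψ) = c(λ)` and `a(ψ) = sin θ a(λ) - cos θ b(λ)`,
`b(ψ) = cos θ a(λ) + sin θ b(λ)`, then `λᵗσλ = -i e^{iθ} ψᵗσψ` coordinatewise. -/
theorem type2_bishop_frenet_spinor_relation (ψ lam : ℂ × ℂ) (θ : ℝ)
    (hB : sc ψ = sc lam)
    (ha : sa ψ = Real.sin θ • sa lam + (-Real.cos θ) • sb lam)
    (hb : sb ψ = Real.cos θ • sa lam + Real.sin θ • sb lam) :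
    ∀ j : Fin 3, (sa lam j : ℂ) + Complex.I * (sb lam j : ℂ)
      = -Complex.I * Complex.exp (θ * Complex.I)
          * ((sa ψ j : ℂ) + Complex.I * (sb ψ j : ℂ)) := by
  intro j
  have h1 : sa ψ j = Real.sin θ * sa lam j - Real.cos θ * sb lam j := by
    rw [ha]; simp [sub_eq_add_neg]
  have h2 : sb ψ j = Real.cos θ * sa lam j + Real.sin θ * sb lam j := by
    rw [hb]; simp
  have h3 := Complex.sin_sq_add_cos_sq (θ : ℂ)
  rw [h1, h2, Complex.exp_mul_I]
  push_cast
  generalize (sa lam j : ℂ) = A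
  generalize (sb lam j : ℂ) = B
  have hI := Complex.I_sq
  generalize Complex.sin (θ : ℂ) = s at *
  generalize Complex.cos (θ : ℂ) = c at *
  generalize Complex.I = i at *
  have e : -i * (c + s * i) * (s * A - c * B + i * (c * A + s * B))
      = (s ^ 2 + c ^ 2) * (A + i * B) := by
    grind
  rw [e, h3, one_mul]
end
end
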